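/- For every natural number r there exists an integer z_r such that J_{rr} = 2·ζ(3) − z_r / d_r³; and for all natural numbers r > s there exists an integer z_{rs} such that J_{rs} = z_{rs} / d_r³. -/

import Mathlib

open MeasureTheory

/-- `J r s = ∫_{(0,1)²} -log(xy)/(1-xy) · xʳ yˢ dμ`. -/
noncomputable def J (r s : ℕ) : ℝ :=
  ∫ x : ℝ × ℝ in Set.Ioo (0 : ℝ) 1 ×ˢ Set.Ioo (0 : ℝ) 1,
    -Real.log (x.1 * x.2) / (1 - x.1 * x.2) * x.1 ^ r * x.2 ^ s


/-- `d m = lcm {1, 2, …, m}`. -/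
def d (m : ℕ) : ℕ := (Finset.Icc 1 m).lcm id

theorem integrableOn_pow_Ioo (n : ℕ) :
    IntegrableOn (fun x : ℝ => x ^ n) (Set.Ioo 0 1) :=
  ((continuous_pow n).integrableOn_Icc (a := (0 : ℝ)) (b := 1)).mono_set Set.Ioo_subset_Icc_self

theorem integral_pow_Ioo (n : ℕ) :
    ∫ x in Set.Ioo (0 : ℝ) 1, x ^ n = 1 / ((n : ℝ) + 1) := by
  rw [← integral_Ioc_eq_integral_Ioo, ← intervalIntegral.integral_of_le zero_le_one, integral_pow]
  simp

theorem intervalIntegrable_neg_log_mul_pow (n : ℕ) :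
    IntervalIntegrable (fun x : ℝ => -Real.log x * x ^ n) volume 0 1 :=
  intervalIntegral.intervalIntegrable_log'.neg.mul_continuousOn (continuous_pow n).continuousOn

theorem integrableOn_neg_log_mul_pow_Ioo (n : ℕ) :
    IntegrableOn (fun x : ℝ => -Real.log x * x ^ n) (Set.Ioo 0 1) :=
  ((intervalIntegrable_iff_integrableOn_Ioo_of_le zero_le_one).1
    (intervalIntegrable_neg_log_mul_pow n))

theorem integral_neg_log_mul_pow_Ioo (n : ℕ) :
    ∫ x in Set.Ioo (0 : ℝ) 1, -Real.log x * x ^ n = 1 / ((n : ℝ) + 1) ^ 2 := by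
  have hn : (n : ℝ) + 1 ≠ 0 := by positivity
  rw [← integral_Ioc_eq_integral_Ioo, ← intervalIntegral.integral_of_le zero_le_one,
    intervalIntegral.integral_eq_sub_of_hasDerivAt_of_le zero_le_one
      (f := fun x => -(x ^ n * (x * Real.log x)) / (n + 1) + x ^ (n + 1) / ((n : ℝ) + 1) ^ 2)
      _ _ (intervalIntegrable_neg_log_mul_pow n)]
  · simp
  · have := Real.continuous_mul_log
    fun_prop
  · intro x hx
    have hx0 : x ≠ 0 := hx.1.ne'
    have h := ((((hasDerivAt_pow (n + 1) x).mul (Real.hasDerivAt_log hx0)).neg.div_const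
      ((n : ℝ) + 1))).add ((hasDerivAt_pow (n + 1) x).div_const (((n : ℝ) + 1) ^ 2))
    convert h using 1
    · ext y
      change _ = -(y ^ (n + 1) * Real.log y) / ((n : ℝ) + 1) + y ^ (n + 1) / ((n : ℝ) + 1) ^ 2
      ring
    · push_cast
      field_simp
      ring

/-- The general term of the geometric expansion of the integrand of `J`, integrated. -/
theorem integrable_and_integral_neg_log_mul_pow (a b : ℕ) :
    IntegrableOn (fun p : ℝ × ℝ => -Real.log (p.1 * p.2) * p.1 ^ a * p.2 ^ b)
      (Set.Ioo 0 1 ×ˢ Set.Ioo 0 1) ∧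
    ∫ p : ℝ × ℝ in Set.Ioo (0 : ℝ) 1 ×ˢ Set.Ioo (0 : ℝ) 1,
      -Real.log (p.1 * p.2) * p.1 ^ a * p.2 ^ b =
      1 / (((a : ℝ) + 1) ^ 2 * (b + 1)) + 1 / (((a : ℝ) + 1) * (b + 1) ^ 2) := by
  have hE : Set.EqOn (fun p : ℝ × ℝ => -Real.log (p.1 * p.2) * p.1 ^ a * p.2 ^ b)
      (fun p => (-Real.log p.1 * p.1 ^ a) * p.2 ^ b + p.1 ^ a * (-Real.log p.2 * p.2 ^ b))
      (Set.Ioo 0 1 ×ˢ Set.Ioo 0 1) := by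
    rintro ⟨x, y⟩ ⟨hx, hy⟩
    simp only
    rw [Real.log_mul hx.1.ne' hy.1.ne']
    ring
  have hS : MeasurableSet (Set.Ioo (0 : ℝ) 1 ×ˢ Set.Ioo (0 : ℝ) 1) :=
    measurableSet_Ioo.prod measurableSet_Ioo
  have h1 : IntegrableOn (fun p : ℝ × ℝ => (-Real.log p.1 * p.1 ^ a) * p.2 ^ b)
      (Set.Ioo 0 1 ×ˢ Set.Ioo 0 1) := by
    rw [IntegrableOn, Measure.volume_eq_prod, ← Measure.prod_restrict]
    exact (integrableOn_neg_log_mul_pow_Ioo a).mul_prod (integrableOn_pow_Ioo b)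
  have h2 : IntegrableOn (fun p : ℝ × ℝ => p.1 ^ a * (-Real.log p.2 * p.2 ^ b))
      (Set.Ioo 0 1 ×ˢ Set.Ioo 0 1) := by
    rw [IntegrableOn, Measure.volume_eq_prod, ← Measure.prod_restrict]
    exact (integrableOn_pow_Ioo a).mul_prod (integrableOn_neg_log_mul_pow_Ioo b)
  refine ⟨(integrableOn_congr_fun hE hS).2 (h1.add h2), ?_⟩
  rw [setIntegral_congr_fun hS hE, integral_add h1 h2, Measure.volume_eq_prod,
    setIntegral_prod_mul (fun x : ℝ => -Real.log x * x ^ a) (fun y : ℝ => y ^ b),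
    setIntegral_prod_mul (fun x : ℝ => x ^ a) (fun y : ℝ => -Real.log y * y ^ b),
    integral_pow_Ioo, integral_pow_Ioo, integral_neg_log_mul_pow_Ioo,
    integral_neg_log_mul_pow_Ioo]
  simp only [one_div, mul_inv]

theorem summable_one_div_nat_add_one_pow {p : ℕ} (hp : 1 < p) :
    Summable fun n : ℕ => 1 / ((n : ℝ) + 1) ^ p := by
  simpa using (summable_nat_add_iff 1).2 (Real.summable_one_div_nat_pow.2 hp)

theorem summable_J_terms (r s : ℕ) :
    Summable fun k : ℕ => 1 / ((((r + k : ℕ) : ℝ) + 1) ^ 2 * (((s + k : ℕ) : ℝ) + 1)) +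
      1 / ((((r + k : ℕ) : ℝ) + 1) * (((s + k : ℕ) : ℝ) + 1) ^ 2) := by
  refine ((summable_one_div_nat_add_one_pow (p := 3) (by norm_num)).mul_left 2).of_nonneg_of_le
    (fun k => by positivity) fun k => ?_
  have hr : (k : ℝ) + 1 ≤ ((r + k : ℕ) : ℝ) + 1 := by push_cast; linarith [r.cast_nonneg (α := ℝ)]
  have hs : (k : ℝ) + 1 ≤ ((s + k : ℕ) : ℝ) + 1 := by push_cast; linarith [s.cast_nonneg (α := ℝ)]
  have e : 2 * (1 / ((k : ℝ) + 1) ^ 3) =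
      1 / (((k : ℝ) + 1) ^ 2 * (k + 1)) + 1 / (((k : ℝ) + 1) * (k + 1) ^ 2) := by
    field_simp
    ring
  rw [e]
  gcongr

theorem hasSum_J (r s : ℕ) :
    HasSum (fun k : ℕ => 1 / ((((r + k : ℕ) : ℝ) + 1) ^ 2 * (((s + k : ℕ) : ℝ) + 1)) +
      1 / ((((r + k : ℕ) : ℝ) + 1) * (((s + k : ℕ) : ℝ) + 1) ^ 2)) (J r s) := by
  have hS : MeasurableSet (Set.Ioo (0 : ℝ) 1 ×ˢ Set.Ioo (0 : ℝ) 1) :=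
    measurableSet_Ioo.prod measurableSet_Ioo
  have hI := fun k : ℕ => integrable_and_integral_neg_log_mul_pow (r + k) (s + k)
  have hnorm (k : ℕ) : Set.EqOn
      (fun p : ℝ × ℝ => ‖-Real.log (p.1 * p.2) * p.1 ^ (r + k) * p.2 ^ (s + k)‖)
      (fun p => -Real.log (p.1 * p.2) * p.1 ^ (r + k) * p.2 ^ (s + k))
      (Set.Ioo 0 1 ×ˢ Set.Ioo 0 1) := by
    rintro ⟨x, y⟩ ⟨⟨hx0, hx1⟩, ⟨hy0, hy1⟩⟩
    have hl : 0 ≤ -Real.log (x * y) :=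
      neg_nonneg.2 (Real.log_nonpos (by positivity) (mul_le_one₀ hx1.le hy0.le hy1.le))
    exact Real.norm_of_nonneg (by simp only at *; positivity)
  have key := hasSum_integral_of_summable_integral_norm (fun k => (hI k).1) (by
    simp_rw [fun k => (setIntegral_congr_fun hS (hnorm k)).trans (hI k).2]
    exact summable_J_terms r s)
  simp_rw [fun k => (hI k).2] at key
  suffices hJ : J r s = ∫ p in Set.Ioo (0 : ℝ) 1 ×ˢ Set.Ioo (0 : ℝ) 1,
      ∑' k : ℕ, -Real.log (p.1 * p.2) * p.1 ^ (r + k) * p.2 ^ (s + k) from hJ ▸ key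
  refine setIntegral_congr_fun hS ?_
  rintro ⟨x, y⟩ ⟨⟨hx0, hx1⟩, ⟨hy0, hy1⟩⟩
  have hxy : x * y < 1 := by nlinarith
  have hg := (hasSum_geometric_of_lt_one (mul_pos hx0 hy0).le hxy).mul_left
    (-Real.log (x * y) * x ^ r * y ^ s)
  simp only
  refine Eq.trans ?_ (hg.tsum_eq.symm.trans (tsum_congr fun k => ?_))
  · rw [div_eq_mul_inv]
    ring
  · rw [mul_pow, pow_add, pow_add]
    ring

theorem dvd_d {m n : ℕ} (hm : 1 ≤ m) (hmn : m ≤ n) : m ∣ d n :=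
  Finset.dvd_lcm (f := id) (Finset.mem_Icc.2 ⟨hm, hmn⟩)

theorem d_ne_zero (n : ℕ) : d n ≠ 0 := by
  rw [d, Ne, Finset.lcm_eq_zero_iff]
  simp

theorem exists_int_one_div_eq_div {N D : ℕ} (hD : D ≠ 0) (h : N ∣ D) :
    ∃ z : ℤ, (1 : ℝ) / N = z / D := by
  obtain ⟨c, rfl⟩ := h
  have hN : N ≠ 0 := left_ne_zero_of_mul hD
  have hc : c ≠ 0 := right_ne_zero_of_mul hD
  refine ⟨c, ?_⟩
  push_cast
  field_simp

theorem exists_int_sum_eq_div {ι : Type*} (S : Finset ι) (f : ι → ℝ) (D : ℝ)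
    (h : ∀ i ∈ S, ∃ z : ℤ, f i = z / D) : ∃ z : ℤ, ∑ i ∈ S, f i = z / D := by
  choose! z hz using h
  refine ⟨∑ i ∈ S, z i, ?_⟩
  rw [Finset.sum_congr rfl hz, ← Finset.sum_div]
  push_cast
  rfl

theorem J_self (r : ℕ) :
    J r r = 2 * ∑' n : ℕ, 1 / ((n : ℝ) + 1) ^ 3 -
      2 * ∑ i ∈ Finset.range r, 1 / ((i : ℝ) + 1) ^ 3 := by
  have h := (summable_one_div_nat_add_one_pow (p := 3) (by norm_num)).sum_add_tsum_nat_add r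
  rw [← h, ← (hasSum_J r r).tsum_eq, mul_add, add_sub_cancel_left, ← tsum_mul_left]
  refine tsum_congr fun k => ?_
  push_cast
  field_simp
  ring

theorem J_add (s t : ℕ) (ht : t ≠ 0) :
    J (s + t) s = ∑ i ∈ Finset.range t, 1 / ((t : ℝ) * ((s + i : ℕ) + 1) ^ 2) := by
  have hf : Summable fun k : ℕ => 1 / ((t : ℝ) * ((s + k : ℕ) + 1) ^ 2) := by
    have := ((summable_nat_add_iff s).2
      (summable_one_div_nat_add_one_pow (p := 2) (by norm_num))).mul_left (1 / (t : ℝ))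
    refine this.congr fun k => ?_
    rw [one_div_mul_one_div, add_comm k s]
  have h := hf.sum_add_tsum_nat_add t
  have hf' := (summable_nat_add_iff t).2 hf
  rw [eq_sub_of_add_eq h, ← hf.tsum_sub hf', ← (hasSum_J (s + t) s).tsum_eq]
  refine tsum_congr fun k => ?_
  have h1 : (s : ℝ) + t + k + 1 ≠ 0 := by positivity
  have h2 : (s : ℝ) + k + 1 ≠ 0 := by positivity
  have h3 : (s : ℝ) + (k + t) + 1 ≠ 0 := by positivity
  push_cast
  field_simp
  ring

theorem J_rr_and_J_rs_linear :
    (∀ r : ℕ, ∃ z : ℤ, J r r =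
        2 * ∑' n : ℕ, 1 / ((n : ℝ) + 1) ^ 3 - (z : ℝ) / (d r : ℝ) ^ 3) ∧
    (∀ r s : ℕ, r > s → ∃ z : ℤ, J r s = (z : ℝ) / (d r : ℝ) ^ 3) := by
  refine ⟨fun r => ?_, fun r s hrs => ?_⟩
  · obtain ⟨z, hz⟩ := exists_int_sum_eq_div (Finset.range r)
      (fun i => 1 / ((i : ℝ) + 1) ^ 3) ((d r : ℝ) ^ 3) fun i hi => by
        have := exists_int_one_div_eq_div (pow_ne_zero 3 (d_ne_zero r))
          (pow_dvd_pow_of_dvd (dvd_d i.succ_pos (Finset.mem_range.1 hi)) 3)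
        simpa using this
    refine ⟨2 * z, ?_⟩
    rw [J_self, hz]
    push_cast
    ring
  · obtain ⟨t, rfl⟩ := Nat.exists_eq_add_of_lt hrs
    rw [add_assoc, J_add s (t + 1) t.succ_ne_zero]
    refine exists_int_sum_eq_div _ _ _ fun i hi => ?_
    have hi' := Finset.mem_range.1 hi
    have := exists_int_one_div_eq_div (pow_ne_zero 3 (d_ne_zero (s + (t + 1))))
      (N := (t + 1) * (s + i + 1) ^ 2) (by
        rw [pow_succ' _ 2]
        exact mul_dvd_mul (dvd_d (by omega) (by omega))
          (pow_dvd_pow_of_dvd (dvd_d (by omega) (by omega)) 2))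
    exact_mod_cast this
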